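/- Let F : ℝ → ℝ be continuous on the open interval (0,1) and suppose there is C ≥ 0 with |2·F(x) − F(x²)| ≤ C for all x ∈ (0,1). Then for every a ∈ (0,1) there exists M such that |F(x)| ≤ M for all x ∈ [a,1). -/

import Mathlib

/-- A bound `M ≥ C` for `F` on `[a², a]` propagates along repeated square roots. -/
theorem abs_le_of_pow_two_pow_le {F : ℝ → ℝ} {C M a : ℝ} (ha : 0 < a) (hCM : C ≤ M)
    (h : ∀ x ∈ Set.Ioo (0:ℝ) 1, |2 * F x - F (x ^ 2)| ≤ C)
    (hM : ∀ x ∈ Set.Icc (a ^ 2) a, |F x| ≤ M) (n : ℕ) :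
    ∀ x, a ^ 2 ≤ x → x < 1 → x ^ 2 ^ n ≤ a → |F x| ≤ M := by
  induction n with
  | zero => exact fun x hx _ hxa => hM x ⟨hx, by simpa using hxa⟩
  | succ n ih =>
    intro x hx hx1 hxa
    rcases le_or_gt x a with hle | hlt
    · exact hM x ⟨hx, hle⟩
    · have hx0 : 0 < x := ha.trans hlt
      have hsq : |F (x ^ 2)| ≤ M :=
        ih (x ^ 2) (by gcongr) (by nlinarith) (by rwa [← pow_mul, ← pow_succ'])
      have hfun := abs_le.mp (h x ⟨hx0, hx1⟩)
      rw [abs_le] at hsq ⊢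
      constructor <;> linarith

theorem stmt_1 (F : ℝ → ℝ) (hF : ContinuousOn F (Set.Ioo (0:ℝ) 1)) (C : ℝ) (hC : 0 ≤ C)
    (h : ∀ x ∈ Set.Ioo (0:ℝ) 1, |2 * F x - F (x ^ 2)| ≤ C) :
    ∀ a ∈ Set.Ioo (0:ℝ) 1, ∃ M : ℝ, ∀ x ∈ Set.Ico a 1, |F x| ≤ M := by
  rintro a ⟨ha0, ha1⟩
  obtain ⟨K, hK⟩ := (isCompact_Icc (a := a ^ 2) (b := a)).exists_bound_of_continuousOn
    (hF.mono fun x hx => ⟨(pow_pos ha0 2).trans_le hx.1, hx.2.trans_lt ha1⟩)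
  refine ⟨max K C, fun x ⟨hax, hx1⟩ => ?_⟩
  have hx0 : 0 < x := ha0.trans_le hax
  obtain ⟨n, hn⟩ := exists_pow_lt_of_lt_one ha0 hx1
  exact abs_le_of_pow_two_pow_le ha0 (le_max_right K C) h
    (fun y hy => (hK y hy).trans (le_max_left K C)) n x (by nlinarith) hx1
    ((pow_le_pow_of_le_one hx0.le hx1.le Nat.lt_two_pow_self.le).trans hn.le)
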